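/- Suppose a user has n⁺ positive items and n⁻ negative items with pairwise distinct scores, let K be an integer with 0 < K ≤ n⁺ and K ≤ n⁻, and suppose exactly m positive items (0 ≤ m ≤ K) are among the K highest-scoring items overall. Then LLPAUC(K/n⁺, K/n⁻) ≥ m²/(n⁺·n⁻). -/

import Mathlib

open Finset

open scoped Classical

noncomputable section

/-- The `K` highest-scoring items under the score function `f`: those items
with fewer than `K` items scoring strictly higher (with pairwise distinct
scores these are exactly the top `K` items, provided `K ≤ card`). -/
def topK {α : Type*} [Fintype α] (K : ℕ) (f : α → ℝ) : Finset α :=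
  Finset.univ.filter fun a => (Finset.univ.filter fun b => f a < f b).card < K

/-- Empirical LLPAUC at `(α, β) = (K/n⁺, K/n⁻)`: the fraction (over all
`n⁺ · n⁻` pairs) of pairs `(i, j)` where `i` is one of the `K` highest-scoring
positive items, `j` is one of the `K` highest-scoring negative items, and
`i`'s score exceeds `j`'s score. -/
def llpauc (np nn K : ℕ) (p : Fin np → ℝ) (q : Fin nn → ℝ) : ℝ :=
  (((topK K p ×ˢ topK K q).filter fun ij => q ij.2 < p ij.1).card : ℝ) /
    ((np : ℝ) * (nn : ℝ))

/-- Empirical OPAUC at `β = K/n⁻`: the fraction (over all `n⁺ · n⁻` pairs) of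
pairs `(i, j)` where `i` is any positive item, `j` is one of the `K`
highest-scoring negative items, and `i`'s score exceeds `j`'s score. -/
def opauc (np nn K : ℕ) (p : Fin np → ℝ) (q : Fin nn → ℝ) : ℝ :=
  (((Finset.univ ×ˢ topK K q).filter fun ij : Fin np × Fin nn =>
      q ij.2 < p ij.1).card : ℝ) / ((np : ℝ) * (nn : ℝ))

/-- The number of positive items among the `K` highest-scoring items overall
(positives scored by `p`, negatives scored by `q`). -/
def hitNum (np nn K : ℕ) (p : Fin np → ℝ) (q : Fin nn → ℝ) : ℕ :=
  (Finset.univ.filter fun i : Fin np =>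
    (Finset.univ.filter fun x : Fin np ⊕ Fin nn =>
      p i < Sum.elim p q x).card < K).card

/-- Recall@K: the number of positive items among the `K` highest-scoring items
overall, divided by the number `n⁺` of positive items. -/
def recallK (np nn K : ℕ) (p : Fin np → ℝ) (q : Fin nn → ℝ) : ℝ :=
  (hitNum np nn K p q : ℝ) / (np : ℝ)

/-- Precision@K: the number of positive items among the `K` highest-scoring
items overall, divided by `K`. -/
def precisionK (np nn K : ℕ) (p : Fin np → ℝ) (q : Fin nn → ℝ) : ℝ :=
  (hitNum np nn K p q : ℝ) / (K : ℝ)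

theorem card_filter_lt_strictAnti {α : Type*} [Fintype α] (f : α → ℝ) {a b : α} (h : f a < f b) :
    (univ.filter fun c => f b < f c).card < (univ.filter fun c => f a < f c).card := by
  refine card_lt_card (ssubset_iff_of_subset ?_ |>.2 ⟨b, by simpa using h, by simp⟩)
  exact fun c hc => by simpa using h.trans (by simpa using hc)

theorem card_filter_lt_antitone {α : Type*} [Fintype α] (f : α → ℝ) {a b : α} (h : f a ≤ f b) :
    (univ.filter fun c => f b < f c).card ≤ (univ.filter fun c => f a < f c).card :=
  card_le_card fun c hc => by simpa using h.trans_lt (by simpa using hc)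

theorem card_filter_lt_injective {α : Type*} [Fintype α] {f : α → ℝ} (hf : Function.Injective f) :
    Function.Injective fun a => (univ.filter fun b => f a < f b).card := by
  intro a b hab
  by_contra hne
  rcases lt_or_gt_of_ne (hf.ne hne) with h | h
  · exact (card_filter_lt_strictAnti f h).ne' hab
  · exact (card_filter_lt_strictAnti f h).ne hab

theorem image_card_filter_lt {α : Type*} [Fintype α] {f : α → ℝ} (hf : Function.Injective f) :
    (univ.image fun a => (univ.filter fun b => f a < f b).card) = range (Fintype.card α) := by
  apply eq_of_subset_of_card_le
  · intro k hk
    obtain ⟨a, -, rfl⟩ := mem_image.1 hk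
    exact mem_range.2 (card_lt_univ_of_notMem (x := a) (by simp))
  · rw [card_image_of_injective _ (card_filter_lt_injective hf), card_range, card_univ]

theorem card_topK {α : Type*} [Fintype α] {K : ℕ} {f : α → ℝ} (hf : Function.Injective f)
    (hK : K ≤ Fintype.card α) : (topK K f).card = K := by
  rw [← card_image_of_injective (topK K f) (card_filter_lt_injective hf)]
  have h : ((topK K f).image fun a => (univ.filter fun b => f a < f b).card) = range K := by
    ext k
    have hk := Finset.ext_iff.1 (image_card_filter_lt hf) k
    simp only [mem_image, mem_univ, true_and, mem_range] at hk
    simp only [mem_image, topK, mem_filter, mem_univ, true_and, mem_range]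
    constructor
    · rintro ⟨a, ha, rfl⟩
      exact ha
    · intro hlt
      obtain ⟨a, rfl⟩ := hk.2 (hlt.trans_le hK)
      exact ⟨a, hlt, rfl⟩
  rw [h, card_range]

/-- with pairwise distinct scores, `0 < K ≤ n⁺`, `K ≤ n⁻`, and
exactly `m ≤ K` positive items among the `K` highest-scoring items overall,
`LLPAUC(K/n⁺, K/n⁻) ≥ m²/(n⁺·n⁻)`. -/
theorem llpauc_ge_of_hitNum (np nn K m : ℕ) (p : Fin np → ℝ) (q : Fin nn → ℝ)
    (hinj : Function.Injective (Sum.elim p q))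
    (hK : 0 < K) (hKp : K ≤ np) (hKn : K ≤ nn)
    (hm : hitNum np nn K p q = m) (hmK : m ≤ K) :
    (m : ℝ) ^ 2 / ((np : ℝ) * (nn : ℝ)) ≤ llpauc np nn K p q := by
  set T := topK K (Sum.elim p q) with hT
  have hTcard : T.card = K := card_topK hinj (by simp; omega)
  have hq : (topK K q).card = K :=
    card_topK (fun a b h => Sum.inr_injective (hinj h)) (by simpa using hKn)
  have hH : T.toLeft.card = m := by
    rw [← hm, hitNum]
    congr 1
    ext i
    simp only [hT, topK, mem_toLeft, mem_filter, mem_univ, true_and]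
    rfl
  have hsum : T.toLeft.card + T.toRight.card = T.card := card_toLeft_add_card_toRight
  have hdiff : m ≤ (topK K q \ T.toRight).card := by
    have := le_card_sdiff T.toRight (topK K q)
    omega
  have hsub : T.toLeft ×ˢ (topK K q \ T.toRight) ⊆
      (topK K p ×ˢ topK K q).filter fun ij => q ij.2 < p ij.1 := by
    rintro ⟨i, j⟩ hij
    simp only [mem_product, mem_sdiff, mem_toLeft, mem_toRight] at hij
    obtain ⟨hi, hjq, hj⟩ := hij
    simp only [hT, topK, mem_filter, mem_univ, true_and] at hi hj
    refine mem_filter.2 ⟨mem_product.2 ⟨?_, hjq⟩, ?_⟩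
    · refine mem_filter.2 ⟨mem_univ _, lt_of_le_of_lt ?_ hi⟩
      exact card_le_card_of_injOn Sum.inl
        (fun c hc => mem_filter.2 ⟨mem_univ _, (mem_filter.1 hc).2⟩)
        Sum.inl_injective.injOn
    · by_contra! h
      exact hj ((card_filter_lt_antitone (Sum.elim p q)
        (a := Sum.inl i) (b := Sum.inr j) h).trans_lt hi)
  have hcard := card_le_card hsub
  rw [card_product, hH] at hcard
  rw [llpauc]
  gcongr
  rw [sq]
  exact_mod_cast (Nat.mul_le_mul_left m hdiff).trans hcard
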